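/- Let X be a Banach space and f : [0,1] → X a variationally Henstock integrable function with primitive Φ(I) = ∫_I f. Let δ : [0,1] → ℝ⁺ be a gauge and P = {(t_1,I_1),…,(t_K,I_K)} a δ-fine Perron (Henstock) partition of [0,1] whose tags t_1,…,t_K are all distinct. Then for each ε>0 there exists a δ-fine interior Henstock partition P' = {(t_1,I'_1),…,(t_K,I'_K)} of [0,1] with the same tags such that Σ_{k=1}^K ‖f(t_k)‖ · | |I_k| − |I'_k| | < ε and Σ_{k=1}^K ‖Φ(I_k) − Φ(I'_k)‖ ≤ ε. -/

import Mathlib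

open Set Metric MeasureTheory Pointwise
open scoped ENNReal NNReal

namespace GaugePaper

variable (X : Type*) [NormedAddCommGroup X] [NormedSpace ℝ X]

/-- `A ∈ cwk(X)`: `A` is a nonempty, convex and weakly compact subset of `X`. -/
def IsCWK (A : Set X) : Prop :=
  A.Nonempty ∧ Convex ℝ A ∧ IsCompact (toWeakSpace ℝ X '' A)

variable {X}

/-- The support function `σ(x*, A)`. -/
noncomputable def suppFn (x' : X →L[ℝ] ℝ) (A : Set X) : ℝ := sSup (x' '' A)

/-- `‖A‖ = sup {‖x‖ : x ∈ A}`. -/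
noncomputable def setNorm (A : Set X) : ℝ := sSup ((fun x => ‖x‖) '' A)

/-- A gauge on `[0,1]`: a positive function. -/
def IsGauge (δ : ℝ → ℝ) : Prop := ∀ t ∈ Icc (0:ℝ) 1, 0 < δ t

/-- A tagged partition of `[0,1]` into `n` (possibly degenerate) nonoverlapping closed
subintervals `[pt i, pt (i+1)]`, with tags `tag i ∈ [0,1]`. -/
structure TP (n : ℕ) where
  pt : Fin (n + 1) → ℝ
  tag : Fin n → ℝ
  mono : Monotone pt
  first : pt 0 = 0
  last : pt (Fin.last n) = 1
  tagMem : ∀ i, tag i ∈ Icc (0:ℝ) 1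

namespace TP

variable {n : ℕ} (P : TP n)

/-- The `i`-th subinterval of the partition. -/
def ivl (i : Fin n) : Set ℝ := Icc (P.pt i.castSucc) (P.pt i.succ)

/-- The length `|I_i|` of the `i`-th subinterval. -/
def len (i : Fin n) : ℝ := P.pt i.succ - P.pt i.castSucc

/-- A Perron (Henstock) partition: each tag belongs to its interval. -/
def IsPerron : Prop := ∀ i, P.tag i ∈ P.ivl i

/-- `δ`-fineness: `I_i ⊆ (t_i - δ(t_i), t_i + δ(t_i))`. -/
def IsFine (δ : ℝ → ℝ) : Prop :=
  ∀ i, P.ivl i ⊆ Ioo (P.tag i - δ (P.tag i)) (P.tag i + δ (P.tag i))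

/-- An interior Henstock partition: each tag is in the interior of its interval, except
possibly for intervals containing `0` or `1`, where the tag may also be `0` or `1`. -/
def IsInterior : Prop :=
  ∀ i, P.tag i ∈ Ioo (P.pt i.castSucc) (P.pt i.succ) ∨
    (((0:ℝ) ∈ P.ivl i ∨ (1:ℝ) ∈ P.ivl i) ∧ P.tag i ∈ P.ivl i ∩ ({0, 1} : Set ℝ))

end TP

/-- Riemann sum of a multifunction: `∑ i |I_i| • Γ(t_i)` (Minkowski sums). -/
def mSum {n : ℕ} (P : TP n) (Γ : ℝ → Set X) : Set X :=
  ∑ i : Fin n, P.len i • Γ (P.tag i)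

/-- Riemann sum of a function: `∑ i |I_i| • f(t_i)`. -/
def fSum {n : ℕ} (P : TP n) (f : ℝ → X) : X :=
  ∑ i : Fin n, P.len i • f (P.tag i)

/-! ### Gauge integrals of multifunctions -/

/-- Henstock integrability of a multifunction `Γ : [0,1] → cwk(X)`. -/
def HenstockIntegrable (Γ : ℝ → Set X) : Prop :=
  ∃ I : Set X, IsCWK X I ∧ ∀ ε > 0, ∃ δ : ℝ → ℝ, IsGauge δ ∧
    ∀ (n : ℕ) (P : TP n), P.IsPerron → P.IsFine δ → hausdorffDist I (mSum P Γ) < ε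

/-- McShane integrability of a multifunction (free tags). -/
def McShaneIntegrable (Γ : ℝ → Set X) : Prop :=
  ∃ I : Set X, IsCWK X I ∧ ∀ ε > 0, ∃ δ : ℝ → ℝ, IsGauge δ ∧
    ∀ (n : ℕ) (P : TP n), P.IsFine δ → hausdorffDist I (mSum P Γ) < ε

/-- `ℋ`-integrability: Henstock integrability with Lebesgue measurable gauges. -/
def HMeasIntegrable (Γ : ℝ → Set X) : Prop :=
  ∃ I : Set X, IsCWK X I ∧ ∀ ε > 0, ∃ δ : ℝ → ℝ, IsGauge δ ∧ AEMeasurable δ volume ∧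
    ∀ (n : ℕ) (P : TP n), P.IsPerron → P.IsFine δ → hausdorffDist I (mSum P Γ) < ε

/-- Birkhoff (`ℳ`-) integrability: McShane integrability with Lebesgue measurable gauges. -/
def BirkhoffIntegrable (Γ : ℝ → Set X) : Prop :=
  ∃ I : Set X, IsCWK X I ∧ ∀ ε > 0, ∃ δ : ℝ → ℝ, IsGauge δ ∧ AEMeasurable δ volume ∧
    ∀ (n : ℕ) (P : TP n), P.IsFine δ → hausdorffDist I (mSum P Γ) < ε

/-! ### Gauge integrals of (single-valued) functions -/

/-- Henstock integrability of a function `f : [0,1] → X`. -/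
def FHenstockIntegrable (f : ℝ → X) : Prop :=
  ∃ w : X, ∀ ε > 0, ∃ δ : ℝ → ℝ, IsGauge δ ∧
    ∀ (n : ℕ) (P : TP n), P.IsPerron → P.IsFine δ → ‖w - fSum P f‖ < ε

/-- McShane integrability of a function. -/
def FMcShaneIntegrable (f : ℝ → X) : Prop :=
  ∃ w : X, ∀ ε > 0, ∃ δ : ℝ → ℝ, IsGauge δ ∧
    ∀ (n : ℕ) (P : TP n), P.IsFine δ → ‖w - fSum P f‖ < ε

/-- `ℋ`-integrability of a function: measurable gauges. -/
def FHMeasIntegrable (f : ℝ → X) : Prop :=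
  ∃ w : X, ∀ ε > 0, ∃ δ : ℝ → ℝ, IsGauge δ ∧ AEMeasurable δ volume ∧
    ∀ (n : ℕ) (P : TP n), P.IsPerron → P.IsFine δ → ‖w - fSum P f‖ < ε

/-- Birkhoff (`ℳ`-) integrability of a function: McShane with measurable gauges. -/
def FBirkhoffIntegrable (f : ℝ → X) : Prop :=
  ∃ w : X, ∀ ε > 0, ∃ δ : ℝ → ℝ, IsGauge δ ∧ AEMeasurable δ volume ∧
    ∀ (n : ℕ) (P : TP n), P.IsFine δ → ‖w - fSum P f‖ < ε

/-- Henstock–Kurzweil integrability of a real-valued function on `[0,1]`. -/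
def HKIntegrable (g : ℝ → ℝ) : Prop :=
  ∃ A : ℝ, ∀ ε > 0, ∃ δ : ℝ → ℝ, IsGauge δ ∧
    ∀ (n : ℕ) (P : TP n), P.IsPerron → P.IsFine δ → |fSum P g - A| < ε

/-! ### Pettis integrals -/

/-- Pettis integrability of a function `f : [0,1] → X`. -/
def FPettisIntegrable (f : ℝ → X) : Prop :=
  (∀ x' : X →L[ℝ] ℝ, IntegrableOn (fun t => x' (f t)) (Icc (0:ℝ) 1) volume) ∧
  ∀ E ⊆ Icc (0:ℝ) 1, NullMeasurableSet E volume →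
    ∃ ν : X, ∀ x' : X →L[ℝ] ℝ, x' ν = ∫ t in E, x' (f t)

/-- Pettis integrability of a multifunction `Γ : [0,1] → cwk(X)`. -/
def PettisIntegrable (Γ : ℝ → Set X) : Prop :=
  (∀ x' : X →L[ℝ] ℝ, IntegrableOn (fun t => suppFn x' (Γ t)) (Icc (0:ℝ) 1) volume) ∧
  ∀ E ⊆ Icc (0:ℝ) 1, NullMeasurableSet E volume →
    ∃ W : Set X, IsCWK X W ∧ ∀ x' : X →L[ℝ] ℝ, suppFn x' W = ∫ t in E, suppFn x' (Γ t)

/-- `f` is a selection of `Γ`. -/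
def Selection (Γ : ℝ → Set X) (f : ℝ → X) : Prop := ∀ t ∈ Icc (0:ℝ) 1, f t ∈ Γ t

/-! ### Variational integrals -/

/-- Finite additivity of an interval multifunction on subintervals of `[0,1]`
(an interval `[a,b] ⊆ [0,1]` is encoded by its endpoints). -/
def AdditiveIntervalMF (Φ : ℝ → ℝ → Set X) : Prop :=
  ∀ a b c : ℝ, 0 ≤ a → a ≤ b → b ≤ c → c ≤ 1 → Φ a c = Φ a b + Φ b c

/-- Finite additivity of a vector-valued interval function on subintervals of `[0,1]`. -/
def AdditiveIntervalF (Φ : ℝ → ℝ → X) : Prop :=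
  ∀ a b c : ℝ, 0 ≤ a → a ≤ b → b ≤ c → c ≤ 1 → Φ a c = Φ a b + Φ b c

/-- `Φ` is a variational Henstock primitive of the multifunction `Γ`. -/
def vHPrimitive (Γ : ℝ → Set X) (Φ : ℝ → ℝ → Set X) : Prop :=
  (∀ a b : ℝ, 0 ≤ a → a ≤ b → b ≤ 1 → IsCWK X (Φ a b)) ∧ AdditiveIntervalMF Φ ∧
  ∀ ε > 0, ∃ δ : ℝ → ℝ, IsGauge δ ∧ ∀ (n : ℕ) (P : TP n), P.IsPerron → P.IsFine δ →
    ∑ i : Fin n, hausdorffDist (Φ (P.pt i.castSucc) (P.pt i.succ)) (P.len i • Γ (P.tag i)) < ε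

/-- Variational Henstock integrability of a multifunction. -/
def vHIntegrable (Γ : ℝ → Set X) : Prop := ∃ Φ : ℝ → ℝ → Set X, vHPrimitive Γ Φ

/-- Variational McShane integrability of a multifunction (free tags). -/
def vMSIntegrable (Γ : ℝ → Set X) : Prop :=
  ∃ Φ : ℝ → ℝ → Set X,
    (∀ a b : ℝ, 0 ≤ a → a ≤ b → b ≤ 1 → IsCWK X (Φ a b)) ∧ AdditiveIntervalMF Φ ∧
    ∀ ε > 0, ∃ δ : ℝ → ℝ, IsGauge δ ∧ ∀ (n : ℕ) (P : TP n), P.IsFine δ →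
      ∑ i : Fin n, hausdorffDist (Φ (P.pt i.castSucc) (P.pt i.succ)) (P.len i • Γ (P.tag i)) < ε

/-- Variational `ℋ`-integrability of a multifunction: measurable gauges. -/
def vHMeasIntegrable (Γ : ℝ → Set X) : Prop :=
  ∃ Φ : ℝ → ℝ → Set X,
    (∀ a b : ℝ, 0 ≤ a → a ≤ b → b ≤ 1 → IsCWK X (Φ a b)) ∧ AdditiveIntervalMF Φ ∧
    ∀ ε > 0, ∃ δ : ℝ → ℝ, IsGauge δ ∧ AEMeasurable δ volume ∧
      ∀ (n : ℕ) (P : TP n), P.IsPerron → P.IsFine δ →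
        ∑ i : Fin n, hausdorffDist (Φ (P.pt i.castSucc) (P.pt i.succ)) (P.len i • Γ (P.tag i)) < ε

/-- `Φ` is a variational Henstock primitive of the function `f`. -/
def FvHPrimitive (f : ℝ → X) (Φ : ℝ → ℝ → X) : Prop :=
  AdditiveIntervalF Φ ∧
  ∀ ε > 0, ∃ δ : ℝ → ℝ, IsGauge δ ∧ ∀ (n : ℕ) (P : TP n), P.IsPerron → P.IsFine δ →
    ∑ i : Fin n, ‖Φ (P.pt i.castSucc) (P.pt i.succ) - P.len i • f (P.tag i)‖ < ε

/-- Variational Henstock integrability of a function. -/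
def FvHIntegrable (f : ℝ → X) : Prop := ∃ Φ : ℝ → ℝ → X, FvHPrimitive f Φ

/-- Variational McShane integrability of a function (free tags). -/
def FvMSIntegrable (f : ℝ → X) : Prop :=
  ∃ Φ : ℝ → ℝ → X, AdditiveIntervalF Φ ∧
    ∀ ε > 0, ∃ δ : ℝ → ℝ, IsGauge δ ∧ ∀ (n : ℕ) (P : TP n), P.IsFine δ →
      ∑ i : Fin n, ‖Φ (P.pt i.castSucc) (P.pt i.succ) - P.len i • f (P.tag i)‖ < ε

/-- Variational `ℋ`-integrability of a function: measurable gauges. -/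
def FvHMeasIntegrable (f : ℝ → X) : Prop :=
  ∃ Φ : ℝ → ℝ → X, AdditiveIntervalF Φ ∧
    ∀ ε > 0, ∃ δ : ℝ → ℝ, IsGauge δ ∧ AEMeasurable δ volume ∧
      ∀ (n : ℕ) (P : TP n), P.IsPerron → P.IsFine δ →
        ∑ i : Fin n, ‖Φ (P.pt i.castSucc) (P.pt i.succ) - P.len i • f (P.tag i)‖ < ε

/-! ### Partial Perron partitions and variational measures -/

/-- A finite tagged Perron family of `n` nonoverlapping closed subintervals
`[a i, b i]` of `[0,1]` (a "partition in `[0,1]`", not necessarily covering it). -/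
structure PTP (n : ℕ) where
  a : Fin n → ℝ
  b : Fin n → ℝ
  tag : Fin n → ℝ
  le : ∀ i, a i ≤ b i
  sub : ∀ i, Icc (a i) (b i) ⊆ Icc (0:ℝ) 1
  nonoverlap : ∀ i j, i ≠ j → (Icc (a i) (b i) ∩ Icc (a j) (b j)).Subsingleton
  perron : ∀ i, tag i ∈ Icc (a i) (b i)

/-- `δ`-fineness of a partial Perron family. -/
def PTP.IsFine {n : ℕ} (P : PTP n) (δ : ℝ → ℝ) : Prop :=
  ∀ i, Icc (P.a i) (P.b i) ⊆ Ioo (P.tag i - δ (P.tag i)) (P.tag i + δ (P.tag i))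

/-- `Var(Ψ, δ, E)` for a scalar interval function `Ψ`. -/
noncomputable def scVar (Ψ : ℝ → ℝ → ℝ) (δ : ℝ → ℝ) (E : Set ℝ) : ℝ≥0∞ :=
  ⨆ (n : ℕ) (P : PTP n) (_ : P.IsFine δ ∧ ∀ i, P.tag i ∈ E),
    ∑ i : Fin n, ENNReal.ofReal |Ψ (P.a i) (P.b i)|

/-- The variational measure `V_Ψ(E)` generated by a scalar interval function `Ψ`. -/
noncomputable def scVarMeasure (Ψ : ℝ → ℝ → ℝ) (E : Set ℝ) : ℝ≥0∞ :=
  ⨅ (δ : ℝ → ℝ) (_ : IsGauge δ), scVar Ψ δ E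


/-- `[a, b]` carries a tag making it a `δ`-fine Perron interval. -/
def FineStep (δ : ℝ → ℝ) (a b : ℝ) : Prop :=
  ∃ τ ∈ Icc a b, τ ∈ Icc (0:ℝ) 1 ∧ Icc a b ⊆ Ioo (τ - δ τ) (τ + δ τ)

/-- Cousin's lemma: any subinterval of `[0,1]` is a chain of `δ`-fine Perron intervals. -/
theorem cousin {δ : ℝ → ℝ} (hδ : IsGauge δ) {a b : ℝ} (ha : 0 ≤ a) (hab : a ≤ b) (hb : b ≤ 1) :
    Relation.ReflTransGen (FineStep δ) a b := by
  set S : Set ℝ := {x | x ∈ Icc a b ∧ Relation.ReflTransGen (FineStep δ) a x} with hS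
  have haS : a ∈ S := ⟨⟨le_rfl, hab⟩, .refl⟩
  have hbdd : BddAbove S := ⟨b, fun x hx => hx.1.2⟩
  set c := sSup S with hc
  have hac : a ≤ c := le_csSup hbdd haS
  have hcb : c ≤ b := csSup_le ⟨a, haS⟩ fun x hx => hx.1.2
  have hc01 : c ∈ Icc (0:ℝ) 1 := ⟨by linarith, by linarith⟩
  have hδc := hδ c hc01
  obtain ⟨x, hx, hxc⟩ := exists_lt_of_lt_csSup ⟨a, haS⟩ (show c - δ c < sSup S by linarith)
  have hxle : x ≤ c := le_csSup hbdd hx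
  set y := min b (c + δ c / 2) with hy
  have hyb : y ≤ b := min_le_left _ _
  have hyc : c ≤ y := le_min hcb (by linarith)
  have hyd : y ≤ c + δ c / 2 := min_le_right _ _
  have hyS : y ∈ S := by
    refine ⟨⟨by linarith, hyb⟩, hx.2.tail ⟨c, ⟨hxle, hyc⟩, hc01, ?_⟩⟩
    intro z hz
    exact ⟨by linarith [hz.1], by linarith [hz.2]⟩
  have hycc : y ≤ c := le_csSup hbdd hyS
  have hyeq : y = b := by
    rcases min_choice b (c + δ c / 2) with h | h
    · exact h
    · exfalso
      have : y = c + δ c / 2 := h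
      linarith
  exact hyeq ▸ hyS.2

/-- There is a `δ`-fine Perron partition of `[0, c]` whose total `e`-weight is at least `v`. -/
def HasFineChain (δ : ℝ → ℝ) (e : ℝ → ℝ → ℝ → ℝ) (v c : ℝ) : Prop :=
  ∃ (n : ℕ) (p t : ℕ → ℝ), p 0 = 0 ∧ p n = c ∧
    (∀ i < n, t i ∈ Icc (p i) (p (i + 1)) ∧ t i ∈ Icc (0:ℝ) 1 ∧
      Icc (p i) (p (i + 1)) ⊆ Ioo (t i - δ (t i)) (t i + δ (t i))) ∧
    v ≤ ∑ i ∈ Finset.range n, e (p i) (p (i + 1)) (t i)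

theorem HasFineChain.snoc {δ : ℝ → ℝ} {e : ℝ → ℝ → ℝ → ℝ} {v a b τ : ℝ}
    (h : HasFineChain δ e v a) (hτ : τ ∈ Icc a b) (hτ' : τ ∈ Icc (0:ℝ) 1)
    (hfine : Icc a b ⊆ Ioo (τ - δ τ) (τ + δ τ)) :
    HasFineChain δ e (v + e a b τ) b := by
  obtain ⟨n, p, t, h0, hn, hstep, hv⟩ := h
  have hp : ∀ i ≤ n, Function.update p (n + 1) b i = p i := fun i hi =>
    Function.update_of_ne (by omega) _ _
  have ht : ∀ i < n, Function.update t n τ i = t i := fun i hi =>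
    Function.update_of_ne (by omega) _ _
  refine ⟨n + 1, Function.update p (n + 1) b, Function.update t n τ, ?_, by simp, ?_, ?_⟩
  · rw [hp 0 (by omega), h0]
  · intro i hi
    rcases Nat.lt_succ_iff_lt_or_eq.1 hi with hi | rfl
    · rw [hp i hi.le, hp (i + 1) hi, ht i hi]
      exact hstep i hi
    · rw [hp i le_rfl, hn]
      simpa using ⟨hτ, hτ', hfine⟩
  · rw [Finset.sum_range_succ, hp n le_rfl, hn]
    have : ∑ i ∈ Finset.range n, e (Function.update p (n + 1) b i)
        (Function.update p (n + 1) b (i + 1)) (Function.update t n τ i) =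
        ∑ i ∈ Finset.range n, e (p i) (p (i + 1)) (t i) := by
      refine Finset.sum_congr rfl fun i hi => ?_
      have hi := Finset.mem_range.1 hi
      rw [hp i hi.le, hp (i + 1) hi, ht i hi]
    rw [this]
    simpa using hv

theorem HasFineChain.trans {δ : ℝ → ℝ} {e : ℝ → ℝ → ℝ → ℝ} (he : ∀ a b t, 0 ≤ e a b t)
    {v a b : ℝ} (h : HasFineChain δ e v a) (hab : Relation.ReflTransGen (FineStep δ) a b) :
    HasFineChain δ e v b := by
  induction hab with
  | refl => exact h
  | tail _ hstep ih =>
    obtain ⟨τ, hτ, hτ', hfine⟩ := hstep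
    obtain ⟨n, p, t, h0, hn, hs, hv⟩ := ih.snoc hτ hτ' hfine
    exact ⟨n, p, t, h0, hn, hs, (le_add_of_nonneg_right (he _ _ _)).trans hv⟩

/-- A single `δ`-fine Perron interval is controlled by the variational Henstock estimate. -/
theorem FvHPrimitive.exists_gauge_norm_sub_lt {f : ℝ → X} {Φ : ℝ → ℝ → X}
    (hΦ : FvHPrimitive f Φ) {ε : ℝ} (hε : 0 < ε) :
    ∃ δ : ℝ → ℝ, IsGauge δ ∧ ∀ a b τ : ℝ, 0 ≤ a → b ≤ 1 → τ ∈ Icc a b →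
      Icc a b ⊆ Ioo (τ - δ τ) (τ + δ τ) → ‖Φ a b - (b - a) • f τ‖ < ε := by
  obtain ⟨δ, hδ, H⟩ := hΦ.2 ε hε
  refine ⟨δ, hδ, fun a b τ ha hb hτ hfine => ?_⟩
  have hab : a ≤ b := hτ.1.trans hτ.2
  let e : ℝ → ℝ → ℝ → ℝ := fun a b t => ‖Φ a b - (b - a) • f t‖
  have he : ∀ a b t, 0 ≤ e a b t := fun _ _ _ => norm_nonneg _
  have h0 : HasFineChain δ e 0 0 := ⟨0, fun _ => 0, fun _ => 0, rfl, rfl, by simp, by simp⟩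
  have h1 := h0.trans he (cousin hδ le_rfl ha (hab.trans hb))
  have h2 := h1.snoc hτ ⟨ha.trans hτ.1, hτ.2.trans hb⟩ hfine
  obtain ⟨n, p, t, hp0, hpn, hs, hv⟩ := h2.trans he (cousin hδ (ha.trans hab) hb le_rfl)
  let P : TP n :=
    { pt := fun i => p i
      tag := fun i => t i
      mono := Fin.monotone_iff_le_succ.2 fun i => by
        simpa using (hs i i.2).1.1.trans (hs i i.2).1.2
      first := by simpa using hp0
      last := by simpa using hpn
      tagMem := fun i => (hs i i.2).2.1 }
  have hlt := H n P (fun i => by simpa [TP.ivl, P] using (hs i i.2).1)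
    (fun i => by simpa [TP.ivl, P] using (hs i i.2).2.2)
  have hsum : ∑ i : Fin n, ‖Φ (P.pt i.castSucc) (P.pt i.succ) - P.len i • f (P.tag i)‖ =
      ∑ i ∈ Finset.range n, e (p i) (p (i + 1)) (t i) := by
    rw [Finset.sum_range]
    simp [P, TP.len, e]
  have : e a b τ < ε := by linarith
  exact this

theorem AdditiveIntervalF.eq_sub {Y : Type*} [NormedAddCommGroup Y] {Φ : ℝ → ℝ → Y}
    (h : AdditiveIntervalF Φ) {a b : ℝ} (ha : 0 ≤ a) (hab : a ≤ b) (hb : b ≤ 1) :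
    Φ a b = Φ 0 b - Φ 0 a := by
  rw [h 0 a b le_rfl ha hab hb, add_sub_cancel_left]

/-- The indefinite variational Henstock integral is continuous. -/
theorem FvHPrimitive.continuousOn {f : ℝ → X} {Φ : ℝ → ℝ → X} (hΦ : FvHPrimitive f Φ) :
    ContinuousOn (Φ 0) (Icc 0 1) := by
  intro t ht
  rw [ContinuousWithinAt, Metric.tendsto_nhdsWithin_nhds]
  intro ε hε
  obtain ⟨δ, hδ, H⟩ := hΦ.exists_gauge_norm_sub_lt (half_pos hε)
  have hM : 0 < ‖f t‖ + 1 := by positivity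
  refine ⟨min (δ t) (ε / 2 / (‖f t‖ + 1)), lt_min (hδ t ht) (by positivity), ?_⟩
  intro s hs hd
  rw [Real.dist_eq, lt_min_iff] at hd
  obtain ⟨hd1, hd2⟩ := hd
  have hd3 : |s - t| * ‖f t‖ ≤ ε / 2 := by
    rw [lt_div_iff₀ hM] at hd2
    nlinarith [abs_nonneg (s - t)]
  have hd1' := abs_lt.1 hd1
  have key : ∀ a b : ℝ, 0 ≤ a → b ≤ 1 → t ∈ Icc a b →
      Icc a b ⊆ Ioo (t - δ t) (t + δ t) → |b - a| = |s - t| → ‖Φ 0 b - Φ 0 a‖ < ε := by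
    intro a b ha hb htab hsub habs
    have h1 := H a b t ha hb htab hsub
    rw [hΦ.1.eq_sub ha (htab.1.trans htab.2) hb] at h1
    have h2 := norm_le_norm_sub_add (Φ 0 b - Φ 0 a) ((b - a) • f t)
    rw [norm_smul, Real.norm_eq_abs, habs] at h2
    linarith
  rw [dist_eq_norm]
  rcases le_total t s with h | h
  · exact key t s ht.1 hs.2 ⟨le_rfl, h⟩
      (fun z hz => ⟨by linarith [hz.1, hδ t ht], by linarith [hz.2]⟩) rfl
  · rw [norm_sub_rev]
    exact key s t hs.1 ht.2 ⟨h, le_rfl⟩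
      (fun z hz => ⟨by linarith [hz.1], by linarith [hz.2, hδ t ht]⟩) (abs_sub_comm _ _)

theorem TP.pt_mem {n : ℕ} (P : TP n) (i : Fin (n + 1)) : P.pt i ∈ Icc (0:ℝ) 1 :=
  ⟨P.first ▸ P.mono (Fin.zero_le i), P.last ▸ P.mono (Fin.le_last i)⟩

theorem TP.IsFine.lt_pt_castSucc {n : ℕ} {P : TP n} {δ : ℝ → ℝ} (h : P.IsFine δ) (j : Fin n) :
    P.tag j - δ (P.tag j) < P.pt j.castSucc :=
  (h j ⟨le_rfl, P.mono j.castSucc_lt_succ.le⟩).1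

theorem TP.IsFine.pt_succ_lt {n : ℕ} {P : TP n} {δ : ℝ → ℝ} (h : P.IsFine δ) (j : Fin n) :
    P.pt j.succ < P.tag j + δ (P.tag j) :=
  (h j ⟨P.mono j.castSucc_lt_succ.le, le_rfl⟩).2

/-- Each division point can be moved slightly so as to separate the two adjacent tags strictly. -/
theorem TP.exists_separating_pt {Y : Type*} [NormedAddCommGroup Y] {G : ℝ → Y}
    (hG : ContinuousOn G (Icc 0 1)) {δ : ℝ → ℝ} {n : ℕ} {P : TP n}
    (hPerron : P.IsPerron) (hfine : P.IsFine δ) (htags : Function.Injective P.tag)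
    {η : ℝ} (hη : 0 < η) (i : Fin (n + 1)) :
    ∃ x : ℝ, (i = 0 → x = 0) ∧ (i = Fin.last n → x = 1) ∧ |P.pt i - x| < η ∧
      ‖G (P.pt i) - G x‖ < η ∧
      (∀ j : Fin n, j.castSucc = i →
        x ≤ P.tag j ∧ (i ≠ 0 → x < P.tag j) ∧ P.tag j - δ (P.tag j) < x) ∧
      (∀ j : Fin n, j.succ = i →
        P.tag j ≤ x ∧ (i ≠ Fin.last n → P.tag j < x) ∧ x < P.tag j + δ (P.tag j)) := by
  by_cases hi : i = 0 ∨ i = Fin.last n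
  · refine ⟨P.pt i, fun h => h ▸ P.first, fun h => h ▸ P.last, by simpa, by simpa, ?_, ?_⟩
    · rintro j rfl
      refine ⟨(hPerron j).1, fun h => absurd (hi.resolve_left h) (Fin.castSucc_lt_last j).ne,
        hfine.lt_pt_castSucc j⟩
    · rintro j rfl
      exact ⟨(hPerron j).2, fun h => absurd (hi.resolve_right h) (Fin.succ_ne_zero j),
        hfine.pt_succ_lt j⟩
  · obtain ⟨hi0, hil⟩ := not_or.1 hi
    obtain ⟨j, rfl⟩ := Fin.exists_succ_eq.2 hi0
    obtain ⟨k, hk⟩ := Fin.exists_castSucc_eq.2 hil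
    have hjp : P.tag j ≤ P.pt j.succ := (hPerron j).2
    have hpk : P.pt j.succ ≤ P.tag k := hk ▸ (hPerron k).1
    have hjk : j ≠ k := by
      rintro rfl
      exact j.castSucc_lt_succ.ne hk
    have hlt : P.tag j < P.tag k := lt_of_le_of_ne (hjp.trans hpk) fun h => hjk (htags h)
    have hcl : P.pt j.succ ∈ closure (Ioo (P.tag j) (P.tag k)) := by
      rw [closure_Ioo hlt.ne]
      exact ⟨hjp, hpk⟩
    have e1 : ∀ᶠ x in nhds (P.pt j.succ), x ∈ Ioo (P.tag k - δ (P.tag k))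
        (P.tag j + δ (P.tag j)) :=
      Ioo_mem_nhds (hk ▸ hfine.lt_pt_castSucc k) (hfine.pt_succ_lt j)
    have e2 := Metric.ball_mem_nhds (P.pt j.succ) hη
    have e3 := eventually_nhdsWithin_iff.1
      ((hG _ (P.pt_mem j.succ)).eventually (Metric.ball_mem_nhds _ hη))
    obtain ⟨x, hx, ⟨hx1, hx2⟩, hx3⟩ :=
      ((mem_closure_iff_frequently.1 hcl).and_eventually
        (e1.and (Filter.Eventually.and e2 e3))).exists
    have hxI : x ∈ Icc (0:ℝ) 1 := ⟨(P.tagMem j).1.trans hx.1.le, hx.2.le.trans (P.tagMem k).2⟩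
    refine ⟨x, fun h => absurd h hi0, fun h => absurd h hil, ?_, ?_, ?_, ?_⟩
    · rw [← Real.dist_eq, dist_comm]
      exact hx3.1
    · rw [← dist_eq_norm, dist_comm]
      exact hx3.2 hxI
    · intro l hl
      obtain rfl : l = k := Fin.castSucc_injective _ (hl.trans hk.symm)
      exact ⟨hx.2.le, fun _ => hx.2, hx1⟩
    · intro l hl
      obtain rfl : l = j := Fin.succ_injective _ hl
      exact ⟨hx.1.le, fun _ => hx.1, hx2⟩

/-- Lemma `ex3` of the paper. Let `f : [0,1] → X` be variationally
Henstock integrable with primitive `Φ`. Given a gauge `δ`, a `δ`-fine Perron partition of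
`[0,1]` with pairwise distinct tags, and `ε > 0`, there is a `δ`-fine *interior* Henstock
partition of `[0,1]` with the same tags such that
`∑_k ‖f(t_k)‖ · ||I_k| - |I'_k|| < ε` and `∑_k ‖Φ(I_k) - Φ(I'_k)‖ ≤ ε`. -/
theorem interior_partition_exists_of_vH
    {X : Type*} [NormedAddCommGroup X] [NormedSpace ℝ X] [CompleteSpace X]
    (f : ℝ → X) (Φ : ℝ → ℝ → X) (hΦ : FvHPrimitive f Φ)
    (δ : ℝ → ℝ) (hδ : IsGauge δ) {n : ℕ} (P : TP n)
    (hPerron : P.IsPerron) (hfine : P.IsFine δ) (htags : Function.Injective P.tag) :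
    ∀ ε > 0, ∃ P' : TP n, P'.tag = P.tag ∧ P'.IsFine δ ∧ P'.IsInterior ∧
      (∑ i : Fin n, ‖f (P.tag i)‖ * |P.len i - P'.len i| < ε) ∧
      ∑ i : Fin n,
        ‖Φ (P.pt i.castSucc) (P.pt i.succ) - Φ (P'.pt i.castSucc) (P'.pt i.succ)‖ ≤ ε := by
  intro ε hε
  set M : ℝ := ∑ i : Fin n, ‖f (P.tag i)‖ + n + 1 with hM
  have hS : 0 ≤ ∑ i : Fin n, ‖f (P.tag i)‖ := Finset.sum_nonneg fun _ _ => norm_nonneg _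
  have hMpos : 0 < M := by positivity
  set η : ℝ := ε / (2 * M) with hη
  have hηpos : 0 < η := by positivity
  have hηM : 2 * η * M = ε := by rw [hη]; field_simp
  choose q hq0 hq1 hqP hqG hql hqr using
    TP.exists_separating_pt hΦ.continuousOn hPerron hfine htags hηpos
  let P' : TP n :=
    { pt := q
      tag := P.tag
      mono := Fin.monotone_iff_le_succ.2 fun i => (hql _ i rfl).1.trans (hqr _ i rfl).1
      first := hq0 0 rfl
      last := hq1 _ rfl
      tagMem := P.tagMem }
  have hq01 : ∀ i, q i ∈ Icc (0:ℝ) 1 := P'.pt_mem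
  refine ⟨P', rfl, fun i z hz => ?_, fun i => ?_, ?_, ?_⟩
  · exact ⟨(hql _ i rfl).2.2.trans_le hz.1, hz.2.trans_lt (hqr _ i rfl).2.2⟩
  · have hmem : P'.tag i ∈ P'.ivl i := ⟨(hql _ i rfl).1, (hqr _ i rfl).1⟩
    by_cases h0 : P.tag i = 0
    · refine Or.inr ⟨Or.inl ?_, hmem, Or.inl h0⟩
      exact h0 ▸ hmem
    by_cases h1 : P.tag i = 1
    · refine Or.inr ⟨Or.inr ?_, hmem, Or.inr h1⟩
      exact h1 ▸ hmem
    refine Or.inl ⟨?_, ?_⟩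
    · by_cases h : i.castSucc = 0
      · exact (hq0 _ h).trans_lt (lt_of_le_of_ne (P.tagMem i).1 (Ne.symm h0))
      · exact (hql _ i rfl).2.1 h
    · by_cases h : i.succ = Fin.last n
      · exact (lt_of_le_of_ne (P.tagMem i).2 h1).trans_eq (hq1 _ h).symm
      · exact (hqr _ i rfl).2.1 h
  · have hlen : ∀ i, |P.len i - P'.len i| ≤ 2 * η := fun i => by
      have h1 := abs_lt.1 (hqP i.castSucc)
      have h2 := abs_lt.1 (hqP i.succ)
      change |(P.pt i.succ - P.pt i.castSucc) - (q i.succ - q i.castSucc)| ≤ 2 * η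
      rw [abs_le]
      constructor <;> linarith
    calc ∑ i : Fin n, ‖f (P.tag i)‖ * |P.len i - P'.len i|
        ≤ ∑ i : Fin n, ‖f (P.tag i)‖ * (2 * η) := by gcongr with i; exact hlen i
      _ = 2 * η * ∑ i : Fin n, ‖f (P.tag i)‖ := by rw [← Finset.sum_mul, mul_comm]
      _ < 2 * η * M := by
        gcongr
        have : (0:ℝ) ≤ n := n.cast_nonneg
        linarith
      _ = ε := hηM
  · have hdiff : ∀ i : Fin n, ‖Φ (P.pt i.castSucc) (P.pt i.succ) -
        Φ (P'.pt i.castSucc) (P'.pt i.succ)‖ ≤ 2 * η := fun i => by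
      have hle := Fin.castSucc_lt_succ (i := i) |>.le
      rw [hΦ.1.eq_sub (P.pt_mem _).1 (P.mono hle) (P.pt_mem _).2,
        hΦ.1.eq_sub (P'.pt_mem _).1 (P'.mono hle) (P'.pt_mem _).2, sub_sub_sub_comm]
      refine (norm_sub_le _ _).trans ?_
      have h1 : ‖Φ 0 (P.pt i.succ) - Φ 0 (P'.pt i.succ)‖ < η := hqG i.succ
      have h2 : ‖Φ 0 (P.pt i.castSucc) - Φ 0 (P'.pt i.castSucc)‖ < η := hqG i.castSucc
      linarith
    calc _ ≤ ∑ _i : Fin n, 2 * η := Finset.sum_le_sum fun i _ => hdiff i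
      _ = 2 * η * n := by simp [mul_comm]
      _ ≤ 2 * η * M := by
        gcongr
        linarith
      _ = ε := hηM

end GaugePaper
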